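/- Let h, α, δ be real constants with 1/2 < h < 1, α > 0 and δ > 0, for x > 0 set η̃(x) = x^{-2h}·exp( (2α/(1-2h))·x^{1-2h} - (δ/(1-h))·x^{2-2h} ), let Z = ∫₀^∞ η̃(x) dx, and let μ be the probability measure on (0,∞) with density η = η̃/Z with respect to Lebesgue measure. If (aₙ) and (bₙ) are sequences of positive reals such that μ((0,aₙ)) = μ((bₙ,∞)) for every n and μ((bₙ,∞)) → 0 as n → ∞, then lim_{n → ∞} [ -(2α/(2h-1))·aₙ^{-(2h-1)} + (δ/(1-h))·bₙ^{2-2h} + log bₙ ] = log(α/δ). -/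

import Mathlib

open Real Set MeasureTheory Filter Topology

/-- The (unnormalized) invariant density of the generalized CIR model. -/
noncomputable def etaT (h α δ x : ℝ) : ℝ :=
  x ^ (-(2*h)) * Real.exp ((2*α/(1-2*h)) * x ^ (1-2*h) - (δ/(1-h)) * x ^ (2-2*h))

/-- The normalizing constant of the invariant density. -/
noncomputable def Zcst (h α δ : ℝ) : ℝ := ∫ x in Set.Ioi (0:ℝ), etaT h α δ x

/-- The normalized invariant density `η = η̃ / Z`. -/
noncomputable def etaN (h α δ x : ℝ) : ℝ := etaT h α δ x / Zcst h α δ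

lemma hasDerivAt_exp_mul_rpow (k s : ℝ) {x : ℝ} (hx : 0 < x) :
    HasDerivAt (fun y : ℝ => Real.exp (k * y ^ s))
      (k * s * x ^ (s - 1) * Real.exp (k * x ^ s)) x := by
  convert ((Real.hasDerivAt_rpow_const (p := s) (Or.inl hx.ne')).const_mul k).exp using 1
  ring

lemma etaT_eq (h α δ x : ℝ) :
    etaT h α δ x = x ^ (-(2*h)) * Real.exp ((2*α/(1-2*h)) * x ^ (1-2*h))
      * Real.exp (-(δ/(1-h)) * x ^ (2-2*h)) := by
  rw [etaT, mul_assoc, ← Real.exp_add]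
  ring_nf

lemma etaT_nonneg (h α δ : ℝ) {x : ℝ} (hx : 0 < x) : 0 ≤ etaT h α δ x := by
  unfold etaT; positivity

lemma measurable_etaT (h α δ : ℝ) : Measurable (etaT h α δ) := by
  unfold etaT; fun_prop

lemma tendsto_exp_rpow_zero {h α : ℝ} (hh1 : 1/2 < h) (hα : 0 < α) :
    Tendsto (fun x : ℝ => Real.exp ((2*α/(1-2*h)) * x ^ (1-2*h))) (𝓝[>] 0) (𝓝 0) := by
  refine Real.tendsto_exp_atBot.comp ?_
  exact (tendsto_rpow_neg_nhdsGT_zero (by linarith)).const_mul_atTop_of_neg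
    (div_neg_of_pos_of_neg (by linarith) (by linarith))

lemma tendsto_exp_rpow_atTop {h : ℝ} (hh1 : 1/2 < h) (k : ℝ) :
    Tendsto (fun x : ℝ => Real.exp (k * x ^ (1-2*h))) atTop (𝓝 1) := by
  have h1 : Tendsto (fun x : ℝ => x ^ (1-2*h)) atTop (𝓝 0) := by
    simpa using tendsto_rpow_neg_atTop (y := 2*h-1) (by linarith)
  simpa [Function.comp_def] using (Real.continuous_exp.tendsto _).comp (h1.const_mul k)

/-- The primitive `exp ((2α/(1-2h)) x^{1-2h})` vanishes at `0+`, which integrates its derivative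
on `(0, a)`. -/
lemma integral_Ioo_rpow_mul_exp {h α : ℝ} (hh1 : 1/2 < h) (hα : 0 < α) {a : ℝ} (ha : 0 < a) :
    IntegrableOn (fun x : ℝ => x ^ (-(2*h)) * Real.exp ((2*α/(1-2*h)) * x ^ (1-2*h))) (Ioo 0 a) ∧
    ∫ x in Ioo 0 a, x ^ (-(2*h)) * Real.exp ((2*α/(1-2*h)) * x ^ (1-2*h))
      = Real.exp ((2*α/(1-2*h)) * a ^ (1-2*h)) / (2*α) := by
  set k := 2*α/(1-2*h) with hk
  have hne : (1-2*h) ≠ 0 := by linarith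
  let f : ℝ → ℝ := fun x => Real.exp (k * x ^ (1-2*h)) / (2*α)
  have hderiv : ∀ x : ℝ, 0 < x →
      HasDerivAt f (x ^ (-(2*h)) * Real.exp (k * x ^ (1-2*h))) x := by
    intro x hx
    refine ((hasDerivAt_exp_mul_rpow k (1-2*h) hx).div_const (2*α)).congr_deriv ?_
    rw [hk, show (1-2*h-1) = -(2*h) by ring]
    field_simp
  have hlim : Tendsto f (𝓝[>] 0) (𝓝 0) := by
    simpa using (tendsto_exp_rpow_zero hh1 hα).div_const (2*α)
  let F : ℝ → ℝ := Function.update f 0 0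
  have hFd : ∀ x : ℝ, 0 < x →
      HasDerivAt F (x ^ (-(2*h)) * Real.exp (k * x ^ (1-2*h))) x := by
    intro x hx
    refine (hderiv x hx).congr_of_eventuallyEq ?_
    filter_upwards [lt_mem_nhds hx] with y hy
    exact Function.update_of_ne hy.ne' _ _
  have hFc : ContinuousOn F (Icc 0 a) := by
    intro x hx
    rcases hx.1.eq_or_lt with rfl | hx0
    · rw [continuousWithinAt_update_same]
      refine hlim.mono_left (nhdsWithin_mono _ ?_)
      rintro y ⟨hy, hy0⟩
      exact lt_of_le_of_ne hy.1 (Ne.symm hy0)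
    · exact (hFd x hx0).continuousAt.continuousWithinAt
  have hint : IntegrableOn (fun x : ℝ => x ^ (-(2*h)) * Real.exp (k * x ^ (1-2*h))) (Ioc 0 a) := by
    refine intervalIntegral.integrableOn_deriv_of_nonneg hFc (fun x hx => hFd x hx.1) ?_
    intro x hx
    have := hx.1
    positivity
  refine ⟨hint.mono_set Ioo_subset_Ioc_self, ?_⟩
  rw [← integral_Ioc_eq_integral_Ioo, ← intervalIntegral.integral_of_le ha.le,
    intervalIntegral.integral_eq_sub_of_hasDerivAt_of_le ha.le hFc (fun x hx => hFd x hx.1)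
      ((intervalIntegrable_iff_integrableOn_Ioc_of_le ha.le).2 hint)]
  simp [F, f, ha.ne']

lemma exp_neg_rpow_le_one {h δ : ℝ} (hh2 : h < 1) (hδ : 0 < δ) {x : ℝ} (hx : 0 < x) :
    Real.exp (-(δ/(1-h)) * x ^ (2-2*h)) ≤ 1 := by
  have : 0 < 1 - h := by linarith
  rw [Real.exp_le_one_iff, neg_mul, neg_nonpos]
  positivity

lemma integral_Ioo_etaT_bounds {h α δ : ℝ} (hh1 : 1/2 < h) (hh2 : h < 1) (hα : 0 < α) (hδ : 0 < δ)
    {a : ℝ} (ha : 0 < a) :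
    IntegrableOn (etaT h α δ) (Ioo 0 a) ∧
    Real.exp ((2*α/(1-2*h)) * a ^ (1-2*h)) / (2*α) * Real.exp (-(δ/(1-h)) * a ^ (2-2*h))
      ≤ ∫ x in Ioo 0 a, etaT h α δ x ∧
    ∫ x in Ioo 0 a, etaT h α δ x ≤ Real.exp ((2*α/(1-2*h)) * a ^ (1-2*h)) / (2*α) := by
  obtain ⟨hint, hval⟩ := integral_Ioo_rpow_mul_exp hh1 hα ha
  have hle : ∀ x ∈ Ioo 0 a,
      etaT h α δ x ≤ x ^ (-(2*h)) * Real.exp ((2*α/(1-2*h)) * x ^ (1-2*h)) := by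
    intro x hx
    have hx0 := hx.1
    rw [etaT_eq]
    exact mul_le_of_le_one_right (by positivity) (exp_neg_rpow_le_one hh2 hδ hx0)
  have hI : IntegrableOn (etaT h α δ) (Ioo 0 a) := by
    refine hint.mono' (measurable_etaT h α δ).aestronglyMeasurable ?_
    filter_upwards [ae_restrict_mem measurableSet_Ioo] with x hx
    rw [Real.norm_of_nonneg (etaT_nonneg h α δ hx.1)]
    exact hle x hx
  refine ⟨hI, ?_, ?_⟩
  · rw [← hval, ← integral_mul_const]
    refine setIntegral_mono_on (hint.mul_const _) hI measurableSet_Ioo fun x hx => ?_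
    have hx0 := hx.1
    have h1 : 0 < 1 - h := by linarith
    rw [etaT_eq]
    refine mul_le_mul_of_nonneg_left (Real.exp_le_exp.2 ?_) (by positivity)
    have h2 : x ^ (2-2*h) ≤ a ^ (2-2*h) := Real.rpow_le_rpow hx0.le hx.2.le (by linarith)
    have h3 : 0 < δ/(1-h) := by positivity
    nlinarith
  · rw [← hval]
    exact setIntegral_mono_on hI hint measurableSet_Ioo hle

/-- The function `x⁻¹ exp (-(δ/(1-h)) x^{2-2h})` vanishes at infinity, which integrates its
derivative on `(b, ∞)`. -/
lemma integral_Ioi_rpow_mul_exp {h δ : ℝ} (hh2 : h < 1) (hδ : 0 < δ) {b : ℝ} (hb : 0 < b) :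
    IntegrableOn (fun x : ℝ => x ^ (-(2*h)) * Real.exp (-(δ/(1-h)) * x ^ (2-2*h))
      * (2*δ + x ^ (2*h-2))) (Ioi b) ∧
    ∫ x in Ioi b, x ^ (-(2*h)) * Real.exp (-(δ/(1-h)) * x ^ (2-2*h)) * (2*δ + x ^ (2*h-2))
      = b⁻¹ * Real.exp (-(δ/(1-h)) * b ^ (2-2*h)) := by
  have h1 : 0 < 1 - h := by linarith
  have hderiv : ∀ x ∈ Ici b,
      HasDerivAt (fun x : ℝ => -(x⁻¹ * Real.exp (-(δ/(1-h)) * x ^ (2-2*h))))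
        (x ^ (-(2*h)) * Real.exp (-(δ/(1-h)) * x ^ (2-2*h)) * (2*δ + x ^ (2*h-2))) x := by
    intro x hx
    have hx0 : 0 < x := hb.trans_le hx
    refine ((hasDerivAt_inv hx0.ne').mul
      (hasDerivAt_exp_mul_rpow (-(δ/(1-h))) (2-2*h) hx0)).neg.congr_deriv ?_
    have e1 : x ^ (-(2*h)) * x ^ (2*h-2) = (x ^ 2)⁻¹ := by
      rw [← Real.rpow_add hx0, ← Real.rpow_natCast, ← Real.rpow_neg hx0.le]
      congr 1
      push_cast
      ring
    have e2 : x⁻¹ * x ^ (2-2*h-1) = x ^ (-(2*h)) := by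
      rw [← Real.rpow_neg_one, ← Real.rpow_add hx0]
      ring_nf
    have e3 : δ/(1-h) * (2-2*h) = 2*δ := by field_simp
    linear_combination Real.exp (-(δ/(1-h)) * x ^ (2-2*h)) *
      (2*δ*e2 + x⁻¹ * x ^ (2-2*h-1) * e3 - e1)
  have hpos : ∀ x ∈ Ioi b,
      0 ≤ x ^ (-(2*h)) * Real.exp (-(δ/(1-h)) * x ^ (2-2*h)) * (2*δ + x ^ (2*h-2)) := by
    intro x hx
    have hx0 : 0 < x := hb.trans hx
    positivity
  have hlim : Tendsto (fun x : ℝ => -(x⁻¹ * Real.exp (-(δ/(1-h)) * x ^ (2-2*h)))) atTop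
      (𝓝 0) := by
    rw [← neg_zero]
    refine (squeeze_zero' ?_ ?_ tendsto_inv_atTop_zero).neg
    · filter_upwards [eventually_gt_atTop 0] with x hx
      positivity
    · filter_upwards [eventually_gt_atTop 0] with x hx
      exact mul_le_of_le_one_right (by positivity) (exp_neg_rpow_le_one hh2 hδ hx)
  refine ⟨integrableOn_Ioi_deriv_of_nonneg' hderiv hpos hlim, ?_⟩
  rw [integral_Ioi_of_hasDerivAt_of_nonneg' hderiv hpos hlim]
  ring

lemma integral_Ioi_etaT_bounds {h α δ : ℝ} (hh1 : 1/2 < h) (hh2 : h < 1) (hα : 0 < α) (hδ : 0 < δ)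
    {b : ℝ} (hb : 0 < b) :
    IntegrableOn (etaT h α δ) (Ioi b) ∧
    b⁻¹ * Real.exp (-(δ/(1-h)) * b ^ (2-2*h)) *
        (Real.exp ((2*α/(1-2*h)) * b ^ (1-2*h)) / (2*δ + b ^ (2*h-2)))
      ≤ ∫ x in Ioi b, etaT h α δ x ∧
    ∫ x in Ioi b, etaT h α δ x ≤ b⁻¹ * Real.exp (-(δ/(1-h)) * b ^ (2-2*h)) / (2*δ) := by
  obtain ⟨hint, hval⟩ := integral_Ioi_rpow_mul_exp hh2 hδ hb
  have hk : 2*α/(1-2*h) < 0 := div_neg_of_pos_of_neg (by linarith) (by linarith)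
  have hle : ∀ x ∈ Ioi b, etaT h α δ x ≤
      x ^ (-(2*h)) * Real.exp (-(δ/(1-h)) * x ^ (2-2*h)) * (2*δ + x ^ (2*h-2)) / (2*δ) := by
    intro x hx
    have hx0 : 0 < x := hb.trans hx
    have hA : Real.exp ((2*α/(1-2*h)) * x ^ (1-2*h)) ≤ 1 := by
      rw [Real.exp_le_one_iff]
      exact mul_nonpos_of_nonpos_of_nonneg hk.le (by positivity)
    have hB : 1 ≤ (2*δ + x ^ (2*h-2)) / (2*δ) := by
      rw [one_le_div (by positivity)]
      have : 0 < x ^ (2*h-2) := by positivity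
      linarith
    rw [etaT_eq, mul_right_comm (x ^ (-(2*h))), mul_div_assoc _ (2*δ + _)]
    exact mul_le_mul_of_nonneg_left (hA.trans hB) (by positivity)
  have hI : IntegrableOn (etaT h α δ) (Ioi b) := by
    refine (hint.div_const (2*δ)).mono' (measurable_etaT h α δ).aestronglyMeasurable ?_
    filter_upwards [ae_restrict_mem measurableSet_Ioi] with x hx
    rw [Real.norm_of_nonneg (etaT_nonneg h α δ (hb.trans hx))]
    exact hle x hx
  refine ⟨hI, ?_, ?_⟩
  · rw [← hval, ← integral_mul_const]
    refine setIntegral_mono_on (hint.mul_const _) hI measurableSet_Ioi fun x hx => ?_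
    have hx0 : 0 < x := hb.trans hx
    have h2 : x ^ (1-2*h) ≤ b ^ (1-2*h) :=
      Real.rpow_le_rpow_of_nonpos hb (le_of_lt hx) (by linarith)
    have h3 : x ^ (2*h-2) ≤ b ^ (2*h-2) :=
      Real.rpow_le_rpow_of_nonpos hb (le_of_lt hx) (by linarith)
    have h4 : Real.exp ((2*α/(1-2*h)) * b ^ (1-2*h)) ≤ Real.exp ((2*α/(1-2*h)) * x ^ (1-2*h)) :=
      Real.exp_le_exp.2 (mul_le_mul_of_nonpos_left h2 hk.le)
    rw [etaT_eq, mul_right_comm (x ^ (-(2*h))) (Real.exp _) (Real.exp _),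
      mul_assoc (x ^ (-(2*h)) * _)]
    refine mul_le_mul_of_nonneg_left ?_ (by positivity)
    rw [← mul_div_assoc, div_le_iff₀ (by positivity), mul_comm]
    exact mul_le_mul h4 (by linarith) (by positivity) (by positivity)
  · rw [← hval, ← integral_div]
    exact setIntegral_mono_on hI (hint.div_const _) measurableSet_Ioi hle

lemma integral_Ioo_etaT_pos {h α δ : ℝ} (hh1 : 1/2 < h) (hh2 : h < 1) (hα : 0 < α) (hδ : 0 < δ)
    {a : ℝ} (ha : 0 < a) : 0 < ∫ x in Ioo 0 a, etaT h α δ x :=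
  lt_of_lt_of_le (by positivity) (integral_Ioo_etaT_bounds hh1 hh2 hα hδ ha).2.1

lemma integral_Ioi_etaT_pos {h α δ : ℝ} (hh1 : 1/2 < h) (hh2 : h < 1) (hα : 0 < α) (hδ : 0 < δ)
    {b : ℝ} (hb : 0 < b) : 0 < ∫ x in Ioi b, etaT h α δ x :=
  lt_of_lt_of_le (by positivity) (integral_Ioi_etaT_bounds hh1 hh2 hα hδ hb).2.1

lemma Zcst_pos {h α δ : ℝ} (hh1 : 1/2 < h) (hh2 : h < 1) (hα : 0 < α) (hδ : 0 < δ) :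
    0 < Zcst h α δ := by
  have hI : IntegrableOn (etaT h α δ) (Ioi 0) := by
    have h2 := (integral_Ioo_etaT_bounds hh1 hh2 hα hδ two_pos).1.union
      (integral_Ioi_etaT_bounds hh1 hh2 hα hδ one_pos).1
    refine h2.mono_set fun x hx => ?_
    rcases lt_or_ge x 2 with hx2 | hx2
    · exact Or.inl ⟨hx, hx2⟩
    · exact Or.inr (lt_of_lt_of_le one_lt_two hx2)
  refine (integral_Ioi_etaT_pos hh1 hh2 hα hδ one_pos).trans_le
    (setIntegral_mono_set hI ?_ (Ioi_subset_Ioi zero_le_one).eventuallyLE)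
  filter_upwards [ae_restrict_mem measurableSet_Ioi] with x hx
  exact etaT_nonneg h α δ hx

lemma tendsto_zero_of_integral_Ioo_etaT {h α δ : ℝ} (hh1 : 1/2 < h) (hh2 : h < 1) (hα : 0 < α)
    (hδ : 0 < δ) {a : ℕ → ℝ} (ha : ∀ n, 0 < a n)
    (h0 : Tendsto (fun n => ∫ y in Ioo 0 (a n), etaT h α δ y) atTop (𝓝 0)) :
    Tendsto a atTop (𝓝[>] 0) := by
  refine tendsto_nhdsWithin_iff.2 ⟨?_, Eventually.of_forall ha⟩
  refine tendsto_order.2 ⟨fun c hc => Eventually.of_forall fun n => hc.trans (ha n),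
    fun c hc => ?_⟩
  filter_upwards [h0.eventually_lt_const (integral_Ioo_etaT_pos hh1 hh2 hα hδ hc)] with n hn
  by_contra! hcn
  refine hn.not_ge (setIntegral_mono_set (integral_Ioo_etaT_bounds hh1 hh2 hα hδ (ha n)).1 ?_
    (Ioo_subset_Ioo_right hcn).eventuallyLE)
  filter_upwards [ae_restrict_mem measurableSet_Ioo] with x hx
  exact etaT_nonneg h α δ hx.1

lemma tendsto_atTop_of_integral_Ioi_etaT {h α δ : ℝ} (hh1 : 1/2 < h) (hh2 : h < 1) (hα : 0 < α)
    (hδ : 0 < δ) {b : ℕ → ℝ} (hb : ∀ n, 0 < b n)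
    (h0 : Tendsto (fun n => ∫ y in Ioi (b n), etaT h α δ y) atTop (𝓝 0)) :
    Tendsto b atTop atTop := by
  refine tendsto_atTop.2 fun c => ?_
  have hc : 0 < max c 1 := lt_max_of_lt_right one_pos
  filter_upwards [h0.eventually_lt_const (integral_Ioi_etaT_pos hh1 hh2 hα hδ hc)] with n hn
  by_contra! hcn
  refine hn.not_ge (setIntegral_mono_set (integral_Ioi_etaT_bounds hh1 hh2 hα hδ (hb n)).1 ?_
    (Ioi_subset_Ioi (hcn.le.trans (le_max_left _ _))).eventuallyLE)
  filter_upwards [ae_restrict_mem measurableSet_Ioi] with x hx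
  exact etaT_nonneg h α δ ((hb n).trans hx)

theorem stmt_10 (h α δ : ℝ) (hh1 : 1/2 < h) (hh2 : h < 1) (hα : 0 < α) (hδ : 0 < δ)
    (a b : ℕ → ℝ) (ha : ∀ n, 0 < a n) (hb : ∀ n, 0 < b n)
    (heq : ∀ n, (∫ y in Set.Ioo 0 (a n), etaN h α δ y) = ∫ y in Set.Ioi (b n), etaN h α δ y)
    (h0 : Tendsto (fun n => ∫ y in Set.Ioi (b n), etaN h α δ y) atTop (𝓝 0)) :
    Tendsto (fun n =>
        -(2*α/(2*h-1)) * (a n) ^ (-(2*h-1)) + (δ/(1-h)) * (b n) ^ (2-2*h)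
          + Real.log (b n))
      atTop (𝓝 (Real.log (α/δ))) := by
  have hZ := Zcst_pos hh1 hh2 hα hδ
  simp only [etaN, integral_div, div_left_inj' hZ.ne'] at heq h0
  replace h0 : Tendsto (fun n => ∫ y in Ioi (b n), etaT h α δ y) atTop (𝓝 0) := by
    simpa [div_mul_cancel₀ _ hZ.ne'] using h0.mul_const (Zcst h α δ)
  have hbt := tendsto_atTop_of_integral_Ioi_etaT hh1 hh2 hα hδ hb h0
  have hat := tendsto_zero_of_integral_Ioo_etaT hh1 hh2 hα hδ ha (by simpa only [heq] using h0)
  have hlow : Tendsto (fun n => 2*α * (Real.exp ((2*α/(1-2*h)) * (b n) ^ (1-2*h)) /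
      (2*δ + (b n) ^ (2*h-2)))) atTop (𝓝 (α/δ)) := by
    have h1 : Tendsto (fun x : ℝ => x ^ (2*h-2)) atTop (𝓝 0) := by
      simpa using tendsto_rpow_neg_atTop (y := 2-2*h) (by linarith)
    have h2 := (((tendsto_exp_rpow_atTop hh1 (2*α/(1-2*h))).div (h1.const_add (2*δ))
      (by positivity)).const_mul (2*α)).comp hbt
    rwa [add_zero, mul_one_div, mul_div_mul_left _ _ two_ne_zero] at h2
  have hup : Tendsto (fun n => α / δ / Real.exp (-(δ/(1-h)) * (a n) ^ (2-2*h))) atTop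
      (𝓝 (α/δ)) := by
    have h1 : Tendsto (fun x : ℝ => Real.exp (-(δ/(1-h)) * x ^ (2-2*h))) (𝓝 0) (𝓝 1) := by
      have h2 : ContinuousAt (fun x : ℝ => Real.exp (-(δ/(1-h)) * x ^ (2-2*h))) 0 :=
        ((Real.continuousAt_rpow_const 0 (2-2*h) (Or.inr (by linarith))).const_mul _).rexp
      simpa [ContinuousAt, Real.zero_rpow (show (2-2*h) ≠ 0 by linarith)] using h2
    simpa [Pi.div_def] using (tendsto_const_nhds (x := α/δ)).div
      (h1.comp (hat.mono_right nhdsWithin_le_nhds)) one_ne_zero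
  have hratio : Tendsto (fun n => Real.exp ((2*α/(1-2*h)) * (a n) ^ (1-2*h)) /
      ((b n)⁻¹ * Real.exp (-(δ/(1-h)) * (b n) ^ (2-2*h)))) atTop (𝓝 (α/δ)) := by
    refine tendsto_of_tendsto_of_tendsto_of_le_of_le hlow hup (fun n => ?_) (fun n => ?_)
    · have hbn := hb n
      have h1 := (integral_Ioi_etaT_bounds hh1 hh2 hα hδ hbn).2.1.trans
        ((heq n).symm.le.trans (integral_Ioo_etaT_bounds hh1 hh2 hα hδ (ha n)).2.2)
      dsimp only
      rw [le_div_iff₀ (by positivity)]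
      rw [le_div_iff₀ (by positivity)] at h1
      linarith
    · have hbn := hb n
      have h1 := (integral_Ioo_etaT_bounds hh1 hh2 hα hδ (ha n)).2.1.trans
        ((heq n).le.trans (integral_Ioi_etaT_bounds hh1 hh2 hα hδ hbn).2.2)
      dsimp only
      rw [div_mul_eq_mul_div, div_le_div_iff₀ (by positivity) (by positivity)] at h1
      rw [div_div, div_le_div_iff₀ (by positivity) (by positivity)]
      linarith
  refine (hratio.log (by positivity)).congr fun n => ?_
  have hbn := hb n
  rw [Real.log_div (by positivity) (by positivity), Real.log_mul (by positivity) (by positivity),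
    Real.log_exp, Real.log_exp, Real.log_inv, ← div_neg (2*α),
    show -(2*h-1) = 1-2*h by ring]
  ring
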